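/- Let H₁,…,H_K ⊂ ℝ^M be subspaces of dimensions d_i, B_i : ℝ^M → H_i linear maps with B_iB_iᵀ = I_{H_i}, and c_i ≥ 0 with Σ_{i=1}^K c_i B_iᵀB_i = I_M. Then for nonnegative integrable functions f_i : H_i → ℝ, ∫_{ℝ^M} Π_{i=1}^K f_i(B_i v)^{c_i} e^{-π|v|²} dv ≤ Π_{i=1}^K (∫_{H_i} f_i(u) e^{-π|u|²} du)^{c_i}. -/

import Mathlib

open MeasureTheory Real

lemma gbl_log_le {z : ℝ} (hz : -1 < z) : Real.log (1 + z) ≤ z - z ^ 2 / 2 + z ^ 3 / 3 := by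
  let g : ℝ → ℝ := fun z => Real.log (1 + z) - (z - z ^ 2 / 2 + z ^ 3 / 3)
  have hd : ∀ x, -1 < x → HasDerivAt g (-x ^ 3 / (1 + x)) x := by
    intro x hx
    have h1 : (1 + x) ≠ 0 := by linarith
    have := (((hasDerivAt_id x).const_add 1).log h1).sub
      ((((hasDerivAt_id x).sub (((hasDerivAt_id x).pow 2).div_const 2))).add
        (((hasDerivAt_id x).pow 3).div_const 3))
    refine this.congr_deriv ?_
    simp only [id, Nat.cast_ofNat]
    field_simp
    ring
  have hg0 : g 0 = 0 := by simp [g]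
  suffices g z ≤ g 0 by simp only [hg0] at this; simp only [g] at this; linarith
  rcases le_total 0 z with h | h
  · have : AntitoneOn g (Set.Ici 0) := by
      apply antitoneOn_of_deriv_nonpos (convex_Ici 0)
      · intro x hx
        exact (hd x (by have : (0:ℝ) ≤ x := hx; linarith)).continuousAt.continuousWithinAt
      · intro x hx
        rw [interior_Ici] at hx
        exact (hd x (by have : (0:ℝ) < x := hx; linarith)).differentiableAt.differentiableWithinAt
      · intro x hx
        rw [interior_Ici] at hx
        have hx : (0:ℝ) < x := hx
        rw [(hd x (by linarith)).deriv]
        rw [neg_div]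
        have : 0 ≤ x ^ 3 / (1 + x) := by positivity
        linarith
    exact this (by simp) h h
  · have : MonotoneOn g (Set.Ioc (-1) 0) := by
      apply monotoneOn_of_deriv_nonneg (convex_Ioc (-1) 0)
      · intro x hx
        exact (hd x hx.1).continuousAt.continuousWithinAt
      · intro x hx
        rw [interior_Ioc] at hx
        exact (hd x hx.1).differentiableAt.differentiableWithinAt
      · intro x hx
        rw [interior_Ioc] at hx
        rw [(hd x hx.1).deriv]
        have h1 : 0 ≤ -x ^ 3 := by
          have : -x ^ 3 = (-x) ^ 3 := by ring
          rw [this]; have := hx.2; apply pow_nonneg; linarith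
        exact div_nonneg h1 (by linarith [hx.1])
    exact this ⟨hz, h⟩ (by simp) h

lemma gbl_exp_le (x : ℝ) : Real.exp x ≤ 1 + x + x ^ 2 / 2 + |x| ^ 3 * Real.exp |x| := by
  have h := Complex.norm_exp_sub_sum_le_norm_mul_exp (x : ℂ) 3
  have h2 : Complex.exp (x : ℂ) - ∑ m ∈ Finset.range 3, (x : ℂ) ^ m / (m.factorial : ℂ)
      = ((Real.exp x - (1 + x + x ^ 2 / 2) : ℝ) : ℂ) := by
    simp [Finset.sum_range_succ, Nat.factorial]
  rw [h2, Complex.norm_real, Complex.norm_real, Real.norm_eq_abs, Real.norm_eq_abs] at h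
  linarith [le_abs_self (Real.exp x - (1 + x + x ^ 2 / 2))]

lemma gbl_sum_le {K : ℕ} {c : Fin K → ℝ} (hc : ∀ i, 0 ≤ c i) {u : Fin K → ℝ} {B : ℝ}
    (hu : ∀ i, |u i| ≤ B) : |∑ i, c i * u i| ≤ (∑ i, c i) * B := by
  rw [Finset.sum_mul]
  refine (Finset.abs_sum_le_sum_abs _ _).trans (Finset.sum_le_sum fun i _ => ?_)
  rw [abs_mul, abs_of_nonneg (hc i)]
  exact mul_le_mul_of_nonneg_left (hu i) (hc i)

lemma gbl_pointwise {K : ℕ} (c : Fin K → ℝ) (hc : ∀ i, 0 ≤ c i) (D : ℝ) (hD : 0 ≤ D) :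
    ∃ C : ℝ, 0 ≤ C ∧ ∀ (Z l : Fin K → ℝ) (ζ : ℝ), 0 ≤ ζ → (∀ i, -1 < Z i) → (∀ i, |Z i| ≤ D) →
      (∀ i, |Z i| ≤ ζ) → (∀ i, |l i| ≤ ζ) → (∀ i, |Z i - l i| ≤ ζ ^ 2) →
      ∏ i, (1 + Z i) ^ (c i) ≤ 1 + ∑ i, c i * Z i +
        ((∑ i, c i * l i) ^ 2 - ∑ i, c i * (l i) ^ 2) / 2 + C * ζ ^ 3 := by
  set s := ∑ i, c i with hs
  have hs0 : 0 ≤ s := Finset.sum_nonneg fun i _ => hc i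
  set A1 := s * (1 + D / 2 + D ^ 2 / 3) with hA1
  have hA10 : 0 ≤ A1 := by positivity
  refine ⟨A1 ^ 3 * Real.exp (A1 * D) + s / 3 + s * (1 / 2 + D / 3) * (A1 + s) / 2 + s ^ 2 + s,
    by positivity, ?_⟩
  intro Z l ζ hζ hZ1 hZD hZζ hl hZl
  set σ := ∑ i, c i * Z i with hσ
  set σ' := ∑ i, c i * l i with hσ'
  set q := ∑ i, c i * (Z i) ^ 2 with hq
  set q' := ∑ i, c i * (l i) ^ 2 with hq'
  set ρ := ∑ i, c i * (Z i ^ 3 / 3) with hρ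
  have e1 : |σ| ≤ s * ζ := gbl_sum_le hc hZζ
  have e1' : |σ'| ≤ s * ζ := gbl_sum_le hc hl
  have e1D : |σ| ≤ s * D := gbl_sum_le hc hZD
  have e2 : |q| ≤ s * ζ ^ 2 := gbl_sum_le hc fun i => by
    rw [abs_pow]; exact pow_le_pow_left₀ (abs_nonneg _) (hZζ i) 2
  have e2D : |q| ≤ s * (D * ζ) := gbl_sum_le hc fun i => by
    rw [abs_pow, sq]; exact mul_le_mul (hZD i) (hZζ i) (abs_nonneg _) hD
  have e2DD : |q| ≤ s * D ^ 2 := gbl_sum_le hc fun i => by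
    rw [abs_pow]; exact pow_le_pow_left₀ (abs_nonneg _) (hZD i) 2
  have cube : ∀ i, |Z i ^ 3 / 3| = |Z i| * (|Z i| * |Z i|) / 3 := fun i => by
    rw [abs_div, abs_pow, abs_of_pos (by norm_num : (0:ℝ) < 3)]; ring
  have e3 : |ρ| ≤ s * (ζ * (ζ * ζ) / 3) := gbl_sum_le hc fun i => by
    rw [cube]; have := hZζ i; gcongr
  have e3D : |ρ| ≤ s * (D * (D * ζ) / 3) := gbl_sum_le hc fun i => by
    rw [cube]; have := hZζ i; have := hZD i; gcongr
  have e3D1 : |ρ| ≤ s * (D * (ζ * ζ) / 3) := gbl_sum_le hc fun i => by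
    rw [cube]; have := hZζ i; have := hZD i; gcongr
  have e3DD : |ρ| ≤ s * (D * (D * D) / 3) := gbl_sum_le hc fun i => by
    rw [cube]; have := hZD i; gcongr
  have e4 : |σ - σ'| ≤ s * ζ ^ 2 := by
    have := gbl_sum_le hc hZl
    simpa [hσ, hσ', ← Finset.sum_sub_distrib, mul_sub] using this
  have e5 : |q - q'| ≤ s * (ζ ^ 2 * (2 * ζ)) := by
    have := gbl_sum_le hc (u := fun i => Z i ^ 2 - l i ^ 2) (B := ζ ^ 2 * (2 * ζ)) fun i => by
      have : Z i ^ 2 - l i ^ 2 = (Z i - l i) * (Z i + l i) := by ring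
      rw [this, abs_mul]
      refine mul_le_mul (hZl i) ?_ (abs_nonneg _) (by positivity)
      linarith [abs_add_le (Z i) (l i), hZζ i, hl i]
    simpa [hq, hq', ← Finset.sum_sub_distrib, mul_sub] using this
  set A := σ - q / 2 + ρ with hA
  have hprod : ∏ i, (1 + Z i) ^ (c i) ≤ Real.exp A := by
    have : ∏ i, (1 + Z i) ^ (c i) = Real.exp (∑ i, c i * Real.log (1 + Z i)) := by
      rw [Real.exp_sum]
      refine Finset.prod_congr rfl fun i _ => ?_
      rw [Real.rpow_def_of_pos (by linarith [hZ1 i]), mul_comm]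
    rw [this]
    apply Real.exp_le_exp.2
    have : A = ∑ i, c i * (Z i - Z i ^ 2 / 2 + Z i ^ 3 / 3) := by
      simp only [hA, hσ, hq, hρ, mul_add, mul_sub, Finset.sum_add_distrib, Finset.sum_sub_distrib,
        Finset.sum_div, mul_div_assoc]
    rw [this]
    exact Finset.sum_le_sum fun i _ => mul_le_mul_of_nonneg_left (gbl_log_le (hZ1 i)) (hc i)
  have absA : |A| ≤ |σ| + |q| / 2 + |ρ| := by
    rw [hA]
    have h1 := abs_add_le (σ - q / 2) ρ
    have h2 := abs_sub σ (q / 2)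
    rw [abs_div] at h2; norm_num at h2
    linarith
  have hAζ : |A| ≤ A1 * ζ := by
    calc |A| ≤ s * ζ + s * (D * ζ) / 2 + s * (D * (D * ζ) / 3) := by linarith
      _ = A1 * ζ := by rw [hA1]; ring
  have hAD : |A| ≤ A1 * D := by
    calc |A| ≤ s * D + s * D ^ 2 / 2 + s * (D * (D * D) / 3) := by linarith
      _ = A1 * D := by rw [hA1]; ring
  have hexp := gbl_exp_le A
  have h3 : |A| ^ 3 * Real.exp |A| ≤ (A1 * ζ) ^ 3 * Real.exp (A1 * D) := by gcongr
  have h4 : A ^ 2 - σ ^ 2 ≤ (s * (1 / 2 + D / 3) * ζ ^ 2) * ((A1 + s) * ζ) := by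
    have : A ^ 2 - σ ^ 2 = (A - σ) * (A + σ) := by ring
    rw [this]
    refine (le_abs_self _).trans ?_
    rw [abs_mul]
    refine mul_le_mul ?_ ?_ (abs_nonneg _) (by positivity)
    · have : A - σ = ρ - q / 2 := by rw [hA]; ring
      rw [this]
      have h2 := abs_sub ρ (q / 2)
      rw [abs_div] at h2; norm_num at h2
      calc _ ≤ s * (D * (ζ * ζ) / 3) + s * ζ ^ 2 / 2 := by linarith
        _ = _ := by ring
    · linarith [abs_add_le A σ]
  have h5 : σ ^ 2 - σ' ^ 2 ≤ (s * ζ ^ 2) * (2 * s * ζ) := by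
    have : σ ^ 2 - σ' ^ 2 = (σ - σ') * (σ + σ') := by ring
    rw [this]
    refine (le_abs_self _).trans ?_
    rw [abs_mul]
    refine mul_le_mul e4 ?_ (abs_nonneg _) (by positivity)
    linarith [abs_add_le σ σ']
  have h6 := (abs_le.1 e5).1
  have h7 := (abs_le.1 e3).2
  nlinarith

section core
open ProbabilityTheory
open scoped RealInnerProductSpace

variable {E : Type*} [NormedAddCommGroup E] [InnerProductSpace ℝ E] [FiniteDimensional ℝ E]
  [MeasurableSpace E] [BorelSpace E]

/-- The class of functions bounded between `a` and `b`, with a first-order Taylor expansion whose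
gradient is fixed by `P`. -/
structure GblNice (P : E →L[ℝ] E) (a b L : ℝ) (h : E → ℝ) : Prop where
  cont : Continuous h
  lb : ∀ x, a ≤ h x
  ub : ∀ x, h x ≤ b
  grad : ∃ w : E → E, Continuous w ∧ (∀ x, ‖w x‖ ≤ L) ∧ (∀ x, P (w x) = w x) ∧
    ∀ x y, |h (x + y) - h x - ⟪w x, y⟫| ≤ L * ‖y‖ ^ 2

lemma gbl_integrable_bdd {F : Type*} [NormedAddCommGroup F] [NormedSpace ℝ F]
    [SecondCountableTopology F] [MeasurableSpace F] [BorelSpace F] {h : E → F}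
    (hc : Continuous h) {b : ℝ} (hb : ∀ x, ‖h x‖ ≤ b) :
    Integrable h (stdGaussian E) :=
  Integrable.of_bound hc.aestronglyMeasurable b (Filter.Eventually.of_forall hb)

lemma gbl_integrable_pow (n : ℕ) : Integrable (fun y : E => ‖y‖ ^ n) (stdGaussian E) := by
  have h := (IsGaussian.memLp_id (stdGaussian E) n (by simp)).integrable_norm_pow' 
  simpa using h

lemma gbl_integrable_one_add_pow (n : ℕ) :
    Integrable (fun y : E => (1 + ‖y‖) ^ n) (stdGaussian E) := by
  have : (fun y : E => (1 + ‖y‖) ^ n) =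
      fun y => ∑ m ∈ Finset.range (n + 1), ‖y‖ ^ m * (n.choose m : ℝ) := by
    ext y; rw [add_comm, add_pow]; simp
  rw [this]
  exact integrable_finsetSum _ fun m _ => (gbl_integrable_pow m).mul_const _

lemma gbl_integral_inner (w : E) : ∫ y, ⟪w, y⟫ ∂(stdGaussian E) = 0 := by
  simpa using integral_strongDual_stdGaussian (innerSL ℝ w)

lemma gbl_integrable_inner (w : E) : Integrable (fun y => ⟪w, y⟫) (stdGaussian E) := by
  simpa using IsGaussian.integrable_dual (stdGaussian E) (innerSL ℝ w)

lemma gbl_integrable_inner_sq (w : E) : Integrable (fun y => ⟪w, y⟫ ^ 2) (stdGaussian E) := by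
  have := (IsGaussian.memLp_dual (stdGaussian E) (innerSL ℝ w) 2 (by simp)).integrable_sq
  simpa using this

lemma gbl_integral_inner_sq (w : E) : ∫ y, ⟪w, y⟫ ^ 2 ∂(stdGaussian E) = ‖w‖ ^ 2 := by
  have h := variance_dual_stdGaussian (innerSL ℝ w)
  rw [variance_of_integral_eq_zero (by fun_prop) (integral_strongDual_stdGaussian _),
    innerSL_apply_norm] at h
  simpa using h

lemma gbl_semigroup {F : E → ℝ} (hF : Continuous F) {b : ℝ} (hb : ∀ x, |F x| ≤ b) (x : E) (t : ℝ) :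
    ∫ y, (∫ z, F (x + t • y + t • z) ∂(stdGaussian E)) ∂(stdGaussian E)
      = ∫ y, F (x + (Real.sqrt 2 * t) • y) ∂(stdGaussian E) := by
  have hm : ((stdGaussian E).prod (stdGaussian E)).map (fun p => p.1 + p.2)
      = (stdGaussian E).map (Real.sqrt 2 • ·) := by
    have : IsProbabilityMeasure (((stdGaussian E).prod (stdGaussian E)).map
      (fun p : E × E => p.1 + p.2)) := Measure.isProbabilityMeasure_map (by fun_prop)
    have : IsProbabilityMeasure ((stdGaussian E).map (Real.sqrt 2 • · : E → E)) :=
      Measure.isProbabilityMeasure_map (by fun_prop)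
    apply Measure.ext_of_charFun
    ext ξ
    rw [charFun_map_add_prod_eq_mul, charFun_map_smul]
    simp only [Pi.mul_apply, charFun_stdGaussian, ← Complex.exp_add, norm_smul]
    congr 1
    have : (Real.sqrt 2) ^ 2 = 2 := Real.sq_sqrt (by norm_num)
    have : ((|Real.sqrt 2| : ℝ) : ℂ) ^ 2 = 2 := by rw [← Complex.ofReal_pow, sq_abs, this]; simp
    simp [mul_pow, this]
    ring
  have h1 : ∫ p, F (x + t • p) ∂(((stdGaussian E).prod (stdGaussian E)).map (fun p => p.1 + p.2))
      = ∫ p : E × E, F (x + t • (p.1 + p.2)) ∂((stdGaussian E).prod (stdGaussian E)) :=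
    integral_map (by fun_prop) (by fun_prop)
  have h2 : ∫ p, F (x + t • p) ∂((stdGaussian E).map (Real.sqrt 2 • ·))
      = ∫ p : E, F (x + t • (Real.sqrt 2 • p)) ∂(stdGaussian E) :=
    integral_map (by fun_prop) (by fun_prop)
  rw [hm, h2, integral_prod] at h1
  · simp only [smul_smul, smul_add] at h1
    simp only [mul_comm (Real.sqrt 2), add_assoc]
    exact h1.symm
  · exact Integrable.of_bound (by fun_prop) b (Filter.Eventually.of_forall fun p => hb _)

lemma GblNice.avg {P : E →L[ℝ] E} {a b L : ℝ} {h : E → ℝ} (hh : GblNice P a b L h)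
    (ha : 0 ≤ a) (t : ℝ) :
    GblNice P a b L (fun x => ∫ y, h (x + t • y) ∂(stdGaussian E)) := by
  have hcont := hh.cont
  have hbd : ∀ x, ‖h x‖ ≤ b := fun x => by
    rw [Real.norm_eq_abs, abs_of_nonneg (ha.trans (hh.lb x))]; exact hh.ub x
  have hint : ∀ x, Integrable (fun y => h (x + t • y)) (stdGaussian E) := fun x =>
    gbl_integrable_bdd (by fun_prop) (fun y => hbd _)
  obtain ⟨w, hw, hwL, hwP, hT⟩ := hh.grad
  have hwint : ∀ x, Integrable (fun y => w (x + t • y)) (stdGaussian E) := fun x =>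
    gbl_integrable_bdd (by fun_prop) (fun y => hwL _)
  refine ⟨?_, ?_, ?_, fun x => ∫ y, w (x + t • y) ∂(stdGaussian E), ?_, ?_, ?_, ?_⟩
  · exact continuous_of_dominated (fun x => by fun_prop)
      (fun x => Filter.Eventually.of_forall fun y => hbd _) (integrable_const b)
      (Filter.Eventually.of_forall fun y => by fun_prop)
  · intro x
    have := integral_mono (integrable_const a) (hint x) (fun y => hh.lb _)
    simpa using this
  · intro x
    have := integral_mono (hint x) (integrable_const b) (fun y => hh.ub _)
    simpa using this
  · exact continuous_of_dominated (fun x => by fun_prop)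
      (fun x => Filter.Eventually.of_forall fun y => hwL _) (integrable_const L)
      (Filter.Eventually.of_forall fun y => by fun_prop)
  · intro x
    have := norm_integral_le_of_norm_le (integrable_const (μ := stdGaussian E) L)
      (Filter.Eventually.of_forall fun y => hwL (x + t • y))
    simpa using this
  · intro x
    rw [← ContinuousLinearMap.integral_comp_comm _ (hwint x)]
    simp only [hwP]
  · intro x v
    have e : (∫ y, h (x + v + t • y) ∂(stdGaussian E)) - (∫ y, h (x + t • y) ∂(stdGaussian E))
        - ⟪∫ y, w (x + t • y) ∂(stdGaussian E), v⟫
        = ∫ y, (h ((x + t • y) + v) - h (x + t • y) - ⟪w (x + t • y), v⟫) ∂(stdGaussian E) := by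
      have i1 : Integrable (fun y => h ((x + t • y) + v)) (stdGaussian E) :=
        gbl_integrable_bdd (by fun_prop) (fun y => hbd _)
      have i2 : Integrable (fun y => ⟪w (x + t • y), v⟫) (stdGaussian E) := (hwint x).inner_const v
      have i3 : Integrable (fun y => h ((x + t • y) + v) - h (x + t • y)) (stdGaussian E) :=
        i1.sub (hint x)
      rw [integral_sub i3 i2, integral_sub i1 (hint x)]
      congr 1
      · simp only [add_right_comm]
      · simp only [real_inner_comm v]
        exact (integral_inner (hwint x) v).symm
    rw [e]
    have := norm_integral_le_of_norm_le (integrable_const (μ := stdGaussian E) (L * ‖v‖ ^ 2))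
      (f := fun y => h ((x + t • y) + v) - h (x + t • y) - ⟪w (x + t • y), v⟫)
      (Filter.Eventually.of_forall fun y => hT (x + t • y) v)
    simpa using this


lemma gbl_local {K : ℕ} (c : Fin K → ℝ) (hc : ∀ i, 0 ≤ c i) (P : Fin K → E →L[ℝ] E)
    (hP : ∀ w : Fin K → E, (∀ i, P i (w i) = w i) →
      ‖∑ i, c i • w i‖ ^ 2 ≤ ∑ i, c i * ‖w i‖ ^ 2)
    (a b L : ℝ) (ha : 0 < a) (hL : 0 ≤ L) :
    ∃ C : ℝ, 0 ≤ C ∧ ∀ h : Fin K → E → ℝ, (∀ i, GblNice (P i) a b L (h i)) →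
      ∀ t : ℝ, 0 ≤ t → t ≤ 1 → ∀ x : E,
      ∫ y, ∏ i, (h i (x + t • y)) ^ (c i) ∂(stdGaussian E) ≤
        (1 + C * t ^ 3) * ∏ i, (∫ y, h i (x + t • y) ∂(stdGaussian E)) ^ (c i) := by
  obtain ⟨C, hC, hpw⟩ := gbl_pointwise c hc (|b| / a + 1) (by positivity)
  set M2 := ∫ y : E, ‖y‖ ^ 2 ∂(stdGaussian E) with hM2
  have hM20 : 0 ≤ M2 := integral_nonneg fun y => by positivity
  set M6 := ∫ y : E, (1 + ‖y‖) ^ 6 ∂(stdGaussian E) with hM6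
  have hM60 : 0 ≤ M6 := integral_nonneg fun y => by positivity
  set Q := 1 + L / a * (2 + M2) with hQ
  have hQ1 : 1 ≤ Q := by
    have : 0 ≤ L / a * (2 + M2) := by positivity
    linarith
  refine ⟨C * Q ^ 3 * M6, by positivity, ?_⟩
  intro h hh t ht0 ht1 x
  have hpos : ∀ i x, 0 < h i x := fun i x => ha.trans_le ((hh i).lb x)
  have hbd : ∀ i x, ‖h i x‖ ≤ |b| := fun i x => by
    rw [Real.norm_eq_abs, abs_of_pos (hpos i x)]; exact ((hh i).ub x).trans (le_abs_self b)
  have hcont : ∀ i, Continuous (h i) := fun i => (hh i).cont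
  have hint : ∀ i, Integrable (fun y => h i (x + t • y)) (stdGaussian E) := fun i =>
    gbl_integrable_bdd (by have := hcont i; fun_prop) (fun y => hbd i _)
  choose w hw hwL hwP hT using fun i => (hh i).grad
  set m : Fin K → ℝ := fun i => ∫ y, h i (x + t • y) ∂(stdGaussian E) with hm
  have hma : ∀ i, a ≤ m i := fun i => ((hh i).avg ha.le t).lb x
  have hm0 : ∀ i, 0 < m i := fun i => ha.trans_le (hma i)
  set u : Fin K → E := fun i => (m i)⁻¹ • w i x with hu
  set Z : E → Fin K → ℝ := fun y i => h i (x + t • y) / m i - 1 with hZ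
  have hTt : ∀ i y, |h i (x + t • y) - h i x - t * ⟪w i x, y⟫| ≤ L * (t ^ 2 * ‖y‖ ^ 2) := by
    intro i y
    have := hT i x (t • y)
    rwa [real_inner_smul_right, norm_smul, mul_pow, Real.norm_eq_abs, sq_abs] at this
  have hmx : ∀ i, |m i - h i x| ≤ L * (t ^ 2 * M2) := by
    intro i
    have e : m i - h i x
        = ∫ y, (h i (x + t • y) - h i x - t * ⟪w i x, y⟫) ∂(stdGaussian E) := by
      have i3 : Integrable (fun y => h i (x + t • y) - h i x) (stdGaussian E) :=
        (hint i).sub (integrable_const _)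
      rw [integral_sub i3 ((gbl_integrable_inner _).const_mul t),
        integral_sub (hint i) (integrable_const _), integral_const_mul, gbl_integral_inner]
      simp [hm]
    rw [e]
    have := norm_integral_le_of_norm_le
      (((gbl_integrable_pow (E := E) 2).const_mul (t ^ 2)).const_mul L)
      (f := fun y => h i (x + t • y) - h i x - t * ⟪w i x, y⟫)
      (Filter.Eventually.of_forall fun y => hTt i y)
    rwa [integral_const_mul, integral_const_mul] at this
  have hZl : ∀ y i, |Z y i - t * ⟪u i, y⟫| ≤ L / a * (1 + M2) * (t ^ 2 * (1 + ‖y‖) ^ 2) := by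
    intro y i
    have e : Z y i - t * ⟪u i, y⟫
        = ((h i (x + t • y) - h i x - t * ⟪w i x, y⟫) - (m i - h i x)) / m i := by
      have := (hm0 i).ne'
      simp only [hZ, hu, real_inner_smul_left]
      field_simp
      ring
    rw [e, abs_div, abs_of_pos (hm0 i), div_le_iff₀ (hm0 i)]
    have h1 : ‖y‖ ^ 2 ≤ (1 + ‖y‖) ^ 2 := by gcongr; linarith
    have h2 : (1:ℝ) ≤ (1 + ‖y‖) ^ 2 := one_le_pow₀ (by linarith [norm_nonneg y])
    calc _ ≤ L * (t ^ 2 * ‖y‖ ^ 2) + L * (t ^ 2 * M2) :=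
          (abs_sub _ _).trans (add_le_add (hTt i y) (hmx i))
      _ ≤ L * (t ^ 2 * (1 + ‖y‖) ^ 2) + L * (t ^ 2 * (M2 * (1 + ‖y‖) ^ 2)) := by
          gcongr
          exact le_mul_of_one_le_right hM20 h2
      _ = L / a * (1 + M2) * (t ^ 2 * (1 + ‖y‖) ^ 2) * a := by field_simp
      _ ≤ _ := by gcongr; exact hma i
  have hl : ∀ y i, |t * ⟪u i, y⟫| ≤ L / a * (t * (1 + ‖y‖)) := by
    intro y i
    have hu' : ‖u i‖ ≤ L / a := by
      rw [hu, norm_smul, norm_inv, Real.norm_eq_abs, abs_of_pos (hm0 i), inv_mul_eq_div]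
      exact div_le_div₀ hL (hwL i x) ha (hma i)
    rw [abs_mul, abs_of_nonneg ht0]
    calc _ ≤ t * (‖u i‖ * ‖y‖) := by gcongr; exact abs_real_inner_le_norm _ _
      _ ≤ t * (L / a * (1 + ‖y‖)) := by gcongr; linarith
      _ = _ := by ring
  have key : ∀ y, ∏ i, (1 + Z y i) ^ (c i) ≤ 1 + ∑ i, c i * Z y i +
        ((∑ i, c i * (t * ⟪u i, y⟫)) ^ 2 - ∑ i, c i * (t * ⟪u i, y⟫) ^ 2) / 2
        + C * (Q * t * (1 + ‖y‖) ^ 2) ^ 3 := by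
    intro y
    have hN : 1 ≤ 1 + ‖y‖ := by linarith [norm_nonneg y]
    have hN2 : 1 + ‖y‖ ≤ (1 + ‖y‖) ^ 2 := by nlinarith
    have hLa : 0 ≤ L / a := by positivity
    have hl' : ∀ i, |t * ⟪u i, y⟫| ≤ L / a * (t * (1 + ‖y‖) ^ 2) := fun i =>
      (hl y i).trans (by gcongr)
    apply hpw _ _ _ (by positivity)
    · intro i
      have : 0 < h i (x + t • y) / m i := div_pos (hpos _ _) (hm0 i)
      simp only [hZ]; linarith
    · intro i
      simp only [hZ]
      refine (abs_sub _ _).trans ?_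
      rw [abs_one, abs_div, abs_of_pos (hm0 i)]
      exact add_le_add_left (div_le_div₀ (abs_nonneg _) (hbd i _) ha (hma i)) _
    · intro i
      have e : Z y i = (Z y i - t * ⟪u i, y⟫) + t * ⟪u i, y⟫ := by ring
      rw [e]
      refine (abs_add_le _ _).trans ((add_le_add (hZl y i) (hl' i)).trans ?_)
      have : t ^ 2 ≤ t := by nlinarith
      calc _ ≤ L / a * (1 + M2) * (t * (1 + ‖y‖) ^ 2) + L / a * (t * (1 + ‖y‖) ^ 2) := by gcongr
        _ ≤ L / a * (1 + M2) * (t * (1 + ‖y‖) ^ 2) + L / a * (t * (1 + ‖y‖) ^ 2)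
            + t * (1 + ‖y‖) ^ 2 := by
            have : 0 ≤ t * (1 + ‖y‖) ^ 2 := by positivity
            linarith
        _ = _ := by rw [hQ]; ring
    · intro i
      refine (hl' i).trans ?_
      rw [mul_assoc]
      gcongr
      rw [hQ]
      nlinarith
    · intro i
      refine (hZl y i).trans ?_
      have h1 : L / a * (1 + M2) ≤ Q := by rw [hQ]; nlinarith
      calc _ ≤ Q * (t ^ 2 * (1 + ‖y‖) ^ 2) := by gcongr
        _ ≤ Q ^ 2 * (t ^ 2 * ((1 + ‖y‖) ^ 2) ^ 2) := by
            gcongr ?_ * (_ * ?_)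
            · nlinarith
            · have : (1:ℝ) ≤ (1 + ‖y‖) ^ 2 := by linarith
              exact le_self_pow₀ this (by norm_num)
        _ = _ := by ring
  have hsum : ∀ y, ∑ i, c i * (t * ⟪u i, y⟫) = t * ⟪∑ i, c i • u i, y⟫ := by
    intro y
    rw [sum_inner, Finset.mul_sum]
    refine Finset.sum_congr rfl fun i _ => ?_
    rw [real_inner_smul_left (u i) y (c i)]; ring
  have hZint : ∀ i, Integrable (fun y => Z y i) (stdGaussian E) := fun i =>
    ((hint i).div_const _).sub (integrable_const _)
  have hZ0 : ∀ i, ∫ y, Z y i ∂(stdGaussian E) = 0 := by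
    intro i
    simp only [hZ]
    rw [integral_sub ((hint i).div_const _) (integrable_const _), integral_div]
    have : m i / m i = 1 := div_self (hm0 i).ne'
    simp only [hm] at this ⊢
    rw [this]; simp
  have I1 : Integrable (fun y => ∑ i, c i * Z y i) (stdGaussian E) :=
    integrable_finsetSum _ fun i _ => (hZint i).const_mul _
  have I1' : Integrable (fun y => 1 + ∑ i, c i * Z y i) (stdGaussian E) :=
    (integrable_const _).add I1
  have I2 : Integrable (fun y => (∑ i, c i * (t * ⟪u i, y⟫)) ^ 2) (stdGaussian E) := by
    simp only [hsum, mul_pow]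
    exact (gbl_integrable_inner_sq _).const_mul _
  have I3' : ∀ i, Integrable (fun y => c i * (t * ⟪u i, y⟫) ^ 2) (stdGaussian E) := fun i => by
    simp only [mul_pow]
    exact ((gbl_integrable_inner_sq _).const_mul _).const_mul _
  have I3 : Integrable (fun y => ∑ i, c i * (t * ⟪u i, y⟫) ^ 2) (stdGaussian E) :=
    integrable_finsetSum _ fun i _ => I3' i
  have I4 : Integrable (fun y => ((∑ i, c i * (t * ⟪u i, y⟫)) ^ 2
      - ∑ i, c i * (t * ⟪u i, y⟫) ^ 2) / 2) (stdGaussian E) := (I2.sub I3).div_const 2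
  have e5 : (fun y : E => C * (Q * t * (1 + ‖y‖) ^ 2) ^ 3)
      = fun y => (C * Q ^ 3 * t ^ 3) * (1 + ‖y‖) ^ 6 := by ext y; ring
  have I5 : Integrable (fun y : E => C * (Q * t * (1 + ‖y‖) ^ 2) ^ 3) (stdGaussian E) := by
    rw [e5]; exact (gbl_integrable_one_add_pow 6).const_mul _
  have I14 : Integrable (fun y => 1 + ∑ i, c i * Z y i + ((∑ i, c i * (t * ⟪u i, y⟫)) ^ 2
      - ∑ i, c i * (t * ⟪u i, y⟫) ^ 2) / 2) (stdGaussian E) := I1'.add I4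
  have hmain : ∫ y, ∏ i, (1 + Z y i) ^ (c i) ∂(stdGaussian E) ≤ 1 + C * Q ^ 3 * M6 * t ^ 3 := by
    refine (integral_mono_of_nonneg (Filter.Eventually.of_forall fun y => ?_) (I14.add I5)
      (Filter.Eventually.of_forall key)).trans ?_
    · refine Finset.prod_nonneg fun i _ => Real.rpow_nonneg ?_ _
      simp only [hZ]
      have : 0 < h i (x + t • y) / m i := div_pos (hpos _ _) (hm0 i)
      linarith
    · simp only [Pi.add_apply]
      rw [integral_add I14 I5, integral_add I1' I4, integral_add (integrable_const _) I1,
        integral_div, integral_sub I2 I3, integral_finsetSum _ fun i _ => I3' i,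
        integral_finsetSum _ fun i _ => (hZint i).const_mul _, e5]
      simp only [hsum, mul_pow, integral_const_mul, gbl_integral_inner_sq, hZ0]
      have hPu := hP u fun i => by simp only [hu, map_smul, hwP]
      have : ∑ i, c i * (t ^ 2 * ‖u i‖ ^ 2) = t ^ 2 * ∑ i, c i * ‖u i‖ ^ 2 := by
        rw [Finset.mul_sum]; exact Finset.sum_congr rfl fun i _ => by ring
      rw [this, ← hM6]
      have := mul_le_mul_of_nonneg_left hPu (sq_nonneg t)
      simp
      linarith
  have e6 : ∀ y, ∏ i, (h i (x + t • y)) ^ (c i)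
      = (∏ i, (1 + Z y i) ^ (c i)) * ∏ i, (m i) ^ (c i) := by
    intro y
    rw [← Finset.prod_mul_distrib]
    refine Finset.prod_congr rfl fun i _ => ?_
    have : 1 + Z y i = h i (x + t • y) / m i := by simp only [hZ]; ring
    rw [this, ← Real.mul_rpow (div_pos (hpos _ _) (hm0 i)).le (hm0 i).le,
      div_mul_cancel₀ _ (hm0 i).ne']
  simp only [e6, integral_mul_const]
  exact mul_le_mul_of_nonneg_right hmain
    (Finset.prod_nonneg fun i _ => Real.rpow_nonneg (hm0 i).le _)

lemma gbl_double {K : ℕ} (c : Fin K → ℝ) (hc : ∀ i, 0 ≤ c i) (P : Fin K → E →L[ℝ] E)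
    (a b L : ℝ) (ha : 0 < a) (ρ t : ℝ) (hρ : 0 ≤ ρ)
    (H : ∀ h : Fin K → E → ℝ, (∀ i, GblNice (P i) a b L (h i)) → ∀ x : E,
      ∫ y, ∏ i, (h i (x + t • y)) ^ (c i) ∂(stdGaussian E) ≤
        ρ * ∏ i, (∫ y, h i (x + t • y) ∂(stdGaussian E)) ^ (c i)) :
    ∀ h : Fin K → E → ℝ, (∀ i, GblNice (P i) a b L (h i)) → ∀ x : E,
      ∫ y, ∏ i, (h i (x + (Real.sqrt 2 * t) • y)) ^ (c i) ∂(stdGaussian E) ≤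
        ρ ^ 2 * ∏ i, (∫ y, h i (x + (Real.sqrt 2 * t) • y) ∂(stdGaussian E)) ^ (c i) := by
  have bound : ∀ h : Fin K → E → ℝ, (∀ i, GblNice (P i) a b L (h i)) →
      Continuous (fun x => ∏ i, (h i x) ^ (c i)) ∧
      ∀ x, |∏ i, (h i x) ^ (c i)| ≤ ∏ i, |b| ^ (c i) := by
    intro h hh
    have hpos : ∀ i x, 0 < h i x := fun i x => ha.trans_le ((hh i).lb x)
    refine ⟨?_, ?_⟩
    · refine continuous_finsetProd _ fun i _ => ?_
      exact (hh i).cont.rpow_const fun x => Or.inl (hpos i x).ne'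
    · intro x
      rw [Finset.abs_prod]
      refine Finset.prod_le_prod (fun i _ => abs_nonneg _) fun i _ => ?_
      rw [abs_of_nonneg (Real.rpow_nonneg (hpos i x).le _)]
      exact Real.rpow_le_rpow (hpos i x).le (((hh i).ub x).trans (le_abs_self b)) (hc i)
  intro h hh x
  have hpos : ∀ i x, 0 < h i x := fun i x => ha.trans_le ((hh i).lb x)
  obtain ⟨b1, b2⟩ := bound h hh
  rw [← gbl_semigroup b1 b2]
  have hs : ∀ i, ∫ y, h i (x + (Real.sqrt 2 * t) • y) ∂(stdGaussian E) =
      ∫ y, (∫ z, h i (x + t • y + t • z) ∂(stdGaussian E)) ∂(stdGaussian E) := fun i =>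
    (gbl_semigroup (hh i).cont (b := b) (fun x => by
      rw [abs_of_pos (hpos i x)]; exact (hh i).ub x) x t).symm
  simp only [hs]
  have hh' : ∀ i, GblNice (P i) a b L (fun x => ∫ z, h i (x + t • z) ∂(stdGaussian E)) :=
    fun i => (hh i).avg ha.le t
  obtain ⟨b1', b2'⟩ := bound _ hh'
  have step := H _ hh' x
  calc _ ≤ ∫ y, ρ * ∏ i, (∫ z, h i (x + t • y + t • z) ∂(stdGaussian E)) ^ (c i)
        ∂(stdGaussian E) := by
        refine integral_mono_of_nonneg (Filter.Eventually.of_forall fun y => ?_) ?_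
          (Filter.Eventually.of_forall fun y => H h hh (x + t • y))
        · exact integral_nonneg fun z => Finset.prod_nonneg fun i _ =>
            Real.rpow_nonneg (hpos _ _).le _
        · refine Integrable.const_mul ?_ _
          exact gbl_integrable_bdd (h := fun y => ∏ i, (∫ z, h i (x + t • y + t • z)
            ∂(stdGaussian E)) ^ (c i)) (b1'.comp (by fun_prop : Continuous fun y => x + t • y))
            (fun y => b2' (x + t • y))
    _ = ρ * ∫ y, ∏ i, (∫ z, h i (x + t • y + t • z) ∂(stdGaussian E)) ^ (c i)
        ∂(stdGaussian E) := integral_const_mul _ _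
    _ ≤ ρ * (ρ * _) := mul_le_mul_of_nonneg_left step hρ
    _ = _ := by ring

lemma gbl_nice {K : ℕ} (c : Fin K → ℝ) (hc : ∀ i, 0 ≤ c i) (P : Fin K → E →L[ℝ] E)
    (hP : ∀ w : Fin K → E, (∀ i, P i (w i) = w i) →
      ‖∑ i, c i • w i‖ ^ 2 ≤ ∑ i, c i * ‖w i‖ ^ 2)
    (a b L : ℝ) (ha : 0 < a) (hL : 0 ≤ L) (h : Fin K → E → ℝ)
    (hh : ∀ i, GblNice (P i) a b L (h i)) (s : ℝ) (hs0 : 0 ≤ s) (hs1 : s ≤ 1) :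
    ∫ y, ∏ i, (h i (s • y)) ^ (c i) ∂(stdGaussian E) ≤
        ∏ i, (∫ y, h i (s • y) ∂(stdGaussian E)) ^ (c i) := by
  obtain ⟨C, hC, hloc⟩ := gbl_local c hc P hP a b L ha hL
  have iter : ∀ n : ℕ, ∀ ρ t : ℝ, 0 ≤ ρ → 
      (∀ h : Fin K → E → ℝ, (∀ i, GblNice (P i) a b L (h i)) → ∀ x : E,
      ∫ y, ∏ i, (h i (x + t • y)) ^ (c i) ∂(stdGaussian E) ≤
        ρ * ∏ i, (∫ y, h i (x + t • y) ∂(stdGaussian E)) ^ (c i)) →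
      (∀ h : Fin K → E → ℝ, (∀ i, GblNice (P i) a b L (h i)) → ∀ x : E,
      ∫ y, ∏ i, (h i (x + (Real.sqrt 2 ^ n * t) • y)) ^ (c i) ∂(stdGaussian E) ≤
        ρ ^ (2 ^ n) *
          ∏ i, (∫ y, h i (x + (Real.sqrt 2 ^ n * t) • y) ∂(stdGaussian E)) ^ (c i)) := by
    intro n
    induction n with
    | zero => intro ρ t hρ H; simpa using H
    | succ n ih =>
      intro ρ t hρ H
      have := gbl_double c hc P a b L ha _ _ (by positivity) (ih ρ t hρ H)
      simpa only [← mul_assoc, ← pow_succ', ← pow_mul, ← pow_succ] using this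
  have h2 : (1:ℝ) ≤ Real.sqrt 2 := by
    rw [show (1:ℝ) = Real.sqrt 1 by simp]; exact Real.sqrt_le_sqrt (by norm_num)
  have h22 : (Real.sqrt 2) ^ 2 = 2 := Real.sq_sqrt (by norm_num)
  have h2lt : (1:ℝ) < Real.sqrt 2 := by nlinarith
  set R := ∏ i, (∫ y, h i (s • y) ∂(stdGaussian E)) ^ (c i) with hR
  have hR0 : 0 ≤ R := Finset.prod_nonneg fun i _ => Real.rpow_nonneg
    (integral_nonneg fun y => ha.le.trans ((hh i).lb _)) _
  have hn : ∀ n : ℕ, ∫ y, ∏ i, (h i (s • y)) ^ (c i) ∂(stdGaussian E) ≤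
      Real.exp (C * s ^ 3 * ((Real.sqrt 2)⁻¹) ^ n) * R := by
    intro n
    have hp : 0 < Real.sqrt 2 ^ n := by positivity
    have hp1 : 1 ≤ Real.sqrt 2 ^ n := one_le_pow₀ h2
    set t := s / Real.sqrt 2 ^ n with ht
    have ht0 : 0 ≤ t := by positivity
    have ht1 : t ≤ 1 := (div_le_one hp).2 (hs1.trans hp1)
    have := iter n (1 + C * t ^ 3) t (by positivity)
      (fun h hh x => hloc h hh t ht0 ht1 x) h hh 0
    rw [ht, mul_div_cancel₀ _ hp.ne'] at this
    simp only [zero_add] at this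
    refine this.trans (mul_le_mul_of_nonneg_right ?_ hR0)
    rw [← ht]
    calc (1 + C * t ^ 3) ^ 2 ^ n ≤ (Real.exp (C * t ^ 3)) ^ 2 ^ n := by
          gcongr
          linarith [Real.add_one_le_exp (C * t ^ 3)]
      _ = Real.exp (C * s ^ 3 * ((Real.sqrt 2)⁻¹) ^ n) := by
          rw [← Real.exp_nat_mul]
          congr 1
          push_cast
          have : (2:ℝ) ^ n = (Real.sqrt 2 ^ n) ^ 2 := by rw [← pow_mul, mul_comm, pow_mul, h22]
          rw [this, ht, inv_pow]
          field_simp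
  have lim : Filter.Tendsto (fun n : ℕ => Real.exp (C * s ^ 3 * ((Real.sqrt 2)⁻¹) ^ n) * R)
      Filter.atTop (nhds (Real.exp (C * s ^ 3 * 0) * R)) := by
    refine Filter.Tendsto.mul_const _ ((Real.continuous_exp.tendsto _).comp ?_)
    exact (tendsto_pow_atTop_nhds_zero_of_lt_one (by positivity)
      (inv_lt_one_of_one_lt₀ h2lt)).const_mul _
  have := ge_of_tendsto' lim hn
  simpa using this


/-- The Gaussian measure with density `exp (-π |v|²)`. -/
noncomputable def gblMeasure (V : Type*) [NormedAddCommGroup V] [InnerProductSpace ℝ V]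
    [FiniteDimensional ℝ V] [MeasurableSpace V] [BorelSpace V] : Measure V :=
  (stdGaussian V).map ((Real.sqrt (2 * π))⁻¹ • ·)

instance : IsProbabilityMeasure (gblMeasure E) := by
  unfold gblMeasure
  exact Measure.isProbabilityMeasure_map (by fun_prop)

lemma gbl_charFun (ξ : E) : charFun (gblMeasure E) ξ = Complex.exp (-(‖ξ‖ ^ 2 / (4 * π) : ℝ)) := by
  rw [gblMeasure, charFun_map_smul, charFun_stdGaussian]
  have h : ‖(Real.sqrt (2 * π))⁻¹ • ξ‖ ^ 2 = ‖ξ‖ ^ 2 / (2 * π) := by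
    rw [norm_smul, mul_pow, Real.norm_eq_abs, sq_abs, inv_pow, Real.sq_sqrt (by positivity)]
    field_simp
  rw [← Complex.ofReal_pow, h]
  congr 1
  push_cast
  ring

lemma gbl_measure_eq : gblMeasure E =
    (volume : Measure E).withDensity (fun v => ENNReal.ofReal (Real.exp (-π * ‖v‖ ^ 2))) := by
  have hint : Integrable (fun v : E => Real.exp (-π * ‖v‖ ^ 2)) := by
    have h := (GaussianFourier.integrable_cexp_neg_mul_sq_norm_add (V := E) (b := (π : ℂ))
      (by simpa using Real.pi_pos) 0 0).re
    refine h.congr (Filter.Eventually.of_forall fun v => ?_)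
    simp only [zero_mul, add_zero]
    have : (-(π : ℂ) * (‖v‖ : ℂ) ^ 2) = ((-π * ‖v‖ ^ 2 : ℝ) : ℂ) := by push_cast; ring
    rw [this, ← Complex.ofReal_exp]
    exact Complex.ofReal_re _
  have : IsFiniteMeasure ((volume : Measure E).withDensity
      (fun v => ENNReal.ofReal (Real.exp (-π * ‖v‖ ^ 2)))) := by
    apply isFiniteMeasure_withDensity_ofReal hint.2
  apply Measure.ext_of_charFun
  ext ξ
  rw [gbl_charFun, charFun_apply, integral_withDensity_eq_integral_toReal_smul (by fun_prop)
    (Filter.Eventually.of_forall fun v => ENNReal.ofReal_lt_top)]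
  have h := GaussianFourier.integral_cexp_neg_mul_sq_norm_add (V := E) (b := (π : ℂ))
      (by simpa using Real.pi_pos) Complex.I ξ
  have hpi : (π : ℂ) ≠ 0 := by exact_mod_cast Real.pi_ne_zero
  rw [div_self hpi, Complex.one_cpow, one_mul] at h
  trans
  · exact (h.trans (by congr 1; push_cast; rw [Complex.I_sq]; ring)).symm
  · refine integral_congr_ae (Filter.Eventually.of_forall fun v => ?_)
    simp only
    rw [ENNReal.toReal_ofReal (Real.exp_pos _).le, Complex.exp_add, Complex.real_smul,
      Complex.ofReal_exp, real_inner_comm]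
    congr 2
    · push_cast; ring
    · ring

lemma gbl_integral_eq (G : E → ℝ) :
    ∫ v, G v * Real.exp (-π * ‖v‖ ^ 2) = ∫ v, G v ∂(gblMeasure E) := by
  rw [gbl_measure_eq, integral_withDensity_eq_integral_toReal_smul (by fun_prop)
    (Filter.Eventually.of_forall fun v => ENNReal.ofReal_lt_top)]
  refine integral_congr_ae (Filter.Eventually.of_forall fun v => ?_)
  simp only
  rw [ENNReal.toReal_ofReal (Real.exp_pos _).le, smul_eq_mul, mul_comm]

lemma gbl_integrable_iff (G : E → ℝ) (h : Integrable fun v => G v * Real.exp (-π * ‖v‖ ^ 2)) :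
    Integrable G (gblMeasure E) := by
  rw [gbl_measure_eq, integrable_withDensity_iff (by fun_prop)
    (Filter.Eventually.of_forall fun v => ENNReal.ofReal_lt_top)]
  refine h.congr (Filter.Eventually.of_forall fun v => ?_)
  simp only
  rw [ENNReal.toReal_ofReal (Real.exp_pos _).le]

variable {F : Type*} [NormedAddCommGroup F] [InnerProductSpace ℝ F] [FiniteDimensional ℝ F]
  [MeasurableSpace F] [BorelSpace F]

lemma gbl_map (B : E →L[ℝ] F) (Bt : F →L[ℝ] E) (hadj : ∀ x y, ⟪B x, y⟫ = ⟪x, Bt y⟫)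
    (hiso : ∀ y, ‖Bt y‖ = ‖y‖) : (gblMeasure E).map B = gblMeasure F := by
  have : IsProbabilityMeasure ((gblMeasure E).map B) :=
    Measure.isProbabilityMeasure_map (by fun_prop)
  apply Measure.ext_of_charFun
  ext ξ
  have h1 : charFun ((gblMeasure E).map B) ξ = charFun (gblMeasure E) (Bt ξ) := by
    rw [charFun_apply, integral_map (by fun_prop) (by fun_prop), charFun_apply]
    simp only [hadj]
  rw [h1, gbl_charFun, gbl_charFun, hiso]

set_option linter.unusedSectionVars false

lemma GblNice.comp {a b L : ℝ} {g : F → ℝ} (hg : GblNice (ContinuousLinearMap.id ℝ F) a b L g)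
    (hL : 0 ≤ L)
    (B : E →L[ℝ] F) (Bt : F →L[ℝ] E) (hadj : ∀ x y, ⟪B x, y⟫ = ⟪x, Bt y⟫)
    (hBB : ∀ y, B (Bt y) = y) (hiso : ∀ y, ‖Bt y‖ = ‖y‖) (hle : ∀ x, ‖B x‖ ≤ ‖x‖) :
    GblNice (Bt.comp B) a b L (fun x => g (B x)) := by
  obtain ⟨w, hw, hwL, -, hT⟩ := hg.grad
  refine ⟨hg.cont.comp B.continuous, fun x => hg.lb _, fun x => hg.ub _,
    fun x => Bt (w (B x)), by fun_prop, fun x => ?_, fun x => ?_, fun x y => ?_⟩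
  · rw [hiso]; exact hwL _
  · simp [hBB]
  · have h := hT (B x) (B y)
    rw [real_inner_comm, hadj, real_inner_comm] at h
    rw [map_add]
    refine h.trans ?_
    gcongr
    exact hle y

lemma GblNice.mono {P : E →L[ℝ] E} {a b L b' L' : ℝ} {g : E → ℝ} (hg : GblNice P a b L g)
    (hb : b ≤ b') (hL : L ≤ L') : GblNice P a b' L' g := by
  obtain ⟨w, hw, hwL, hwP, hT⟩ := hg.grad
  exact ⟨hg.cont, hg.lb, fun x => (hg.ub x).trans hb, w, hw, fun x => (hwL x).trans hL, hwP,
    fun x y => (hT x y).trans (by gcongr)⟩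

lemma gbl_smooth_nice {g : F → ℝ} {a e : ℝ} (hg : ContDiff ℝ 2 g) (ha : ∀ x, a ≤ g x)
    (hs : HasCompactSupport (fun x => g x - e)) :
    ∃ b L, 0 ≤ L ∧ GblNice (ContinuousLinearMap.id ℝ F) a b L g := by
  have hd : fderiv ℝ (fun x => g x - e) = fderiv ℝ g := by
    ext1 x; exact fderiv_sub_const e
  have hds : HasCompactSupport (fderiv ℝ g) := hd ▸ hs.fderiv ℝ
  have hd1 : ContDiff ℝ 1 (fderiv ℝ g) := hg.fderiv_right (by norm_num)
  obtain ⟨b, hb⟩ := hs.exists_bound_of_continuous (hg.continuous.sub continuous_const)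
  obtain ⟨L1, hL1⟩ := hds.exists_bound_of_continuous hd1.continuous
  obtain ⟨L2, hL2⟩ := hd1.lipschitzWith_of_hasCompactSupport hds (by norm_num)
  refine ⟨b + e, max L1 L2, le_max_of_le_right L2.2, hg.continuous, ha, fun x => ?_,
    fun x => (InnerProductSpace.toDual ℝ F).symm (fderiv ℝ g x), ?_, ?_, ?_, ?_⟩
  · have := (le_abs_self _).trans (hb x)
    linarith
  · exact (InnerProductSpace.toDual ℝ F).symm.continuous.comp hd1.continuous
  · intro x
    rw [LinearIsometryEquiv.norm_map]
    exact (hL1 x).trans (le_max_left _ _)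
  · intro x; rfl
  · intro x y
    rw [InnerProductSpace.toDual_symm_apply]
    have := (convex_closedBall x ‖y‖).norm_image_sub_le_of_norm_fderiv_le' (𝕜 := ℝ) (f := g)
      (φ := fderiv ℝ g x) (C := L2 * ‖y‖) (x := x) (y := x + y)
      (fun z _ => (hg.differentiable (by norm_num)) z) (fun z hz => ?_) (by simp) (by simp)
    · rw [add_sub_cancel_left] at this
      refine this.trans ?_
      rw [mul_assoc, ← sq]
      gcongr
      exact le_max_right _ _
    · have h1 := hL2.dist_le_mul z x
      rw [dist_eq_norm] at h1
      refine h1.trans ?_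
      gcongr
      exact hz

lemma gbl_approx {f : F → ℝ} (hf : ∀ x, 0 ≤ f x) {ν : Measure F} [IsProbabilityMeasure ν]
    (hi : Integrable f ν) {ε : ℝ} (hε : 0 < ε) :
    ∃ g : F → ℝ, (∃ b L, 0 ≤ L ∧ GblNice (ContinuousLinearMap.id ℝ F) ε b L g) ∧
      Integrable g ν ∧ ∫ x, |f x - g x| ∂ν ≤ 2 * ε := by
  obtain ⟨g, hgs, hg, hgε⟩ := MemLp.exist_eLpNorm_sub_le (by simp) le_rfl
    (memLp_one_iff_integrable.2 hi) hε
  have hgi : Integrable g ν := hg.continuous.integrable_of_hasCompactSupport hgs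
  have hpos : ∀ x, 0 < g x ^ 2 + ε ^ 2 := fun x => by positivity
  have hsm : ContDiff ℝ 2 (fun x => Real.sqrt (g x ^ 2 + ε ^ 2)) :=
    (((hg.of_le (WithTop.coe_le_coe.2 le_top)).pow 2).add contDiff_const).sqrt fun x => (hpos x).ne'
  have hlb : ∀ x, ε ≤ Real.sqrt (g x ^ 2 + ε ^ 2) := fun x =>
    Real.le_sqrt_of_sq_le (by nlinarith [sq_nonneg (g x)])
  have hsup : HasCompactSupport (fun x => Real.sqrt (g x ^ 2 + ε ^ 2) - ε) := by
    have : HasCompactSupport ((fun r : ℝ => Real.sqrt (r ^ 2 + ε ^ 2) - ε) ∘ g) :=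
      hgs.comp_left (by simp [Real.sqrt_sq hε.le])
    exact this
  obtain ⟨b, L, hL, hn⟩ := gbl_smooth_nice hsm hlb hsup
  have hni : Integrable (fun x => Real.sqrt (g x ^ 2 + ε ^ 2)) ν :=
    Integrable.of_bound hsm.continuous.aestronglyMeasurable b (Filter.Eventually.of_forall fun x => by
      rw [Real.norm_eq_abs, abs_of_nonneg (Real.sqrt_nonneg _)]; exact hn.ub x)
  refine ⟨_, ⟨b, L, hL, hn⟩, hni, ?_⟩
  have h1 : ∫ x, |f x - g x| ∂ν ≤ ε := by
    rw [eLpNorm_one_eq_lintegral_enorm] at hgε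
    have := integral_norm_eq_lintegral_enorm (hi.sub hgi).aestronglyMeasurable
    simp only [Real.norm_eq_abs] at this
    simp only [Pi.sub_apply] at this hgε
    rw [this]
    exact ENNReal.toReal_le_of_le_ofReal hε.le hgε
  have h2 : ∀ x, |f x - Real.sqrt (g x ^ 2 + ε ^ 2)| ≤ |f x - g x| + ε := by
    intro x
    have u1 : |g x| ≤ Real.sqrt (g x ^ 2 + ε ^ 2) := Real.abs_le_sqrt (by nlinarith)
    have u2 : Real.sqrt (g x ^ 2 + ε ^ 2) ≤ |g x| + ε := by
      rw [Real.sqrt_le_left (by positivity)]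
      nlinarith [abs_nonneg (g x), sq_abs (g x)]
    have u3 : |f x - abs (g x)| ≤ |f x - g x| := by
      conv_lhs => rw [← abs_of_nonneg (hf x)]
      exact abs_abs_sub_abs_le _ _
    have := abs_le.1 u3
    rw [abs_le]
    constructor <;> linarith
  have : ∫ x, |f x - Real.sqrt (g x ^ 2 + ε ^ 2)| ∂ν ≤ ∫ x, (|f x - g x| + ε) ∂ν :=
    integral_mono (hi.sub hni).abs ((hi.sub hgi).abs.add (integrable_const _)) h2
  have i3 : Integrable (fun x => |f x - g x|) ν := (hi.sub hgi).abs
  rw [integral_add i3 (integrable_const _)] at this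
  simp only [integral_const, probReal_univ, smul_eq_mul, one_mul] at this
  linarith

end core

theorem geometric_brascamp_lieb
    {M K : ℕ} (d : Fin K → ℕ)
    (B : ∀ i, EuclideanSpace ℝ (Fin M) →ₗ[ℝ] EuclideanSpace ℝ (Fin (d i)))
    (hB : ∀ i, (B i) ∘ₗ (LinearMap.adjoint (B i)) = LinearMap.id)
    (c : Fin K → ℝ) (hc : ∀ i, 0 ≤ c i)
    (hsum : ∑ i, c i • ((LinearMap.adjoint (B i)) ∘ₗ (B i)) = LinearMap.id)
    (f : ∀ i, EuclideanSpace ℝ (Fin (d i)) → ℝ)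
    (hf_nonneg : ∀ i u, 0 ≤ f i u)
    (hf_meas : ∀ i, Measurable (f i))
    (hf_int : ∀ i, Integrable (fun u => f i u * Real.exp (-π * ‖u‖ ^ 2))) :
    ∫ v : EuclideanSpace ℝ (Fin M),
        (∏ i, f i (B i v) ^ (c i)) * Real.exp (-π * ‖v‖ ^ 2)
      ≤ ∏ i, (∫ u : EuclideanSpace ℝ (Fin (d i)),
          f i u * Real.exp (-π * ‖u‖ ^ 2)) ^ (c i) := by
  simp only [gbl_integral_eq]
  have hfi : ∀ i, Integrable (f i) (gblMeasure _) := fun i => gbl_integrable_iff _ (hf_int i)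
  set μ := gblMeasure (EuclideanSpace ℝ (Fin M)) with hμ
  -- continuous versions
  let BL : ∀ i, EuclideanSpace ℝ (Fin M) →L[ℝ] EuclideanSpace ℝ (Fin (d i)) :=
    fun i => LinearMap.toContinuousLinearMap (B i)
  let BT : ∀ i, EuclideanSpace ℝ (Fin (d i)) →L[ℝ] EuclideanSpace ℝ (Fin M) :=
    fun i => LinearMap.toContinuousLinearMap (LinearMap.adjoint (B i))
  have hBc : ∀ i, Continuous (B i) := fun i => (BL i).continuous
  have hadj : ∀ i x y, inner ℝ (BL i x) y = inner ℝ x (BT i y) := fun i x y =>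
    (LinearMap.adjoint_inner_right (B i) x y).symm
  have hBB : ∀ i y, BL i (BT i y) = y := fun i y => LinearMap.congr_fun (hB i) y
  have hiso : ∀ i y, ‖BT i y‖ = ‖y‖ := by
    intro i y
    have h := hadj i (BT i y) y
    rw [hBB, real_inner_self_eq_norm_sq, real_inner_self_eq_norm_sq] at h
    exact ((sq_eq_sq₀ (norm_nonneg _) (norm_nonneg _)).1 h).symm
  have hle : ∀ i x, ‖BL i x‖ ≤ ‖x‖ := by
    intro i x
    have h := hadj i x (BL i x)
    rw [real_inner_self_eq_norm_sq] at h
    have h2 := real_inner_le_norm x (BT i (BL i x))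
    rw [hiso, ← h] at h2
    by_contra hlt
    push Not at hlt
    nlinarith [norm_nonneg x, norm_nonneg (BL i x)]
  have hid : ∀ v, ∑ i, c i • BT i (BL i v) = v := by
    intro v
    have := LinearMap.congr_fun hsum v
    simp [LinearMap.sum_apply] at this
    exact this
  let P : Fin K → EuclideanSpace ℝ (Fin M) →L[ℝ] EuclideanSpace ℝ (Fin M) :=
    fun i => (BT i).comp (BL i)
  have hP : ∀ w : Fin K → EuclideanSpace ℝ (Fin M), (∀ i, P i (w i) = w i) →
      ‖∑ i, c i • w i‖ ^ 2 ≤ ∑ i, c i * ‖w i‖ ^ 2 := by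
    intro w hw
    set v := ∑ i, c i • w i with hv
    have e1 : ‖v‖ ^ 2 = ∑ i, c i * inner ℝ (BL i (w i)) (BL i v) := by
      rw [← real_inner_self_eq_norm_sq]
      conv_lhs => enter [2]; rw [hv]
      rw [sum_inner]
      refine Finset.sum_congr rfl fun i _ => ?_
      have hwi : BT i (BL i (w i)) = w i := hw i
      have h := hadj i v (BL i (w i))
      rw [hwi] at h
      have h2 : inner ℝ (w i) v = inner ℝ (BL i (w i)) (BL i v) := by
        rw [real_inner_comm, ← h, real_inner_comm]
      rw [real_inner_smul_left, h2]
    have e2 : ‖v‖ ^ 2 = ∑ i, c i * ‖BL i v‖ ^ 2 := by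
      rw [← real_inner_self_eq_norm_sq]
      conv_lhs => enter [3]; rw [← hid v]
      rw [inner_sum]
      refine Finset.sum_congr rfl fun i _ => ?_
      rw [real_inner_smul_right, ← hadj, real_inner_self_eq_norm_sq]
    have e3 : ∑ i, c i * inner ℝ (BL i (w i)) (BL i v)
        ≤ ∑ i, (c i * ‖w i‖ ^ 2 + c i * ‖BL i v‖ ^ 2) / 2 := by
      refine Finset.sum_le_sum fun i _ => ?_
      have h1 := real_inner_le_norm (BL i (w i)) (BL i v)
      have h2 := mul_le_mul_of_nonneg_right (hle i (w i)) (norm_nonneg (BL i v))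
      have h3 : inner ℝ (BL i (w i)) (BL i v) ≤ (‖w i‖ ^ 2 + ‖BL i v‖ ^ 2) / 2 := by
        nlinarith [sq_nonneg (‖w i‖ - ‖BL i v‖)]
      have := mul_le_mul_of_nonneg_left h3 (hc i)
      linarith
    rw [← Finset.sum_div, Finset.sum_add_distrib, ← e1, ← e2] at e3
    linarith
  have hmap : ∀ i, μ.map (BL i) = gblMeasure _ := fun i => gbl_map (BL i) (BT i) (hadj i) (hiso i)
  have hmp : ∀ i, MeasurePreserving (BL i) μ (gblMeasure _) := fun i =>
    ⟨by fun_prop, hmap i⟩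
  -- inequality for nice functions
  have nice_ineq : ∀ (ε : ℝ), 0 < ε → ∀ g : ∀ i, EuclideanSpace ℝ (Fin (d i)) → ℝ,
      (∀ i, ∃ b L, 0 ≤ L ∧ GblNice (ContinuousLinearMap.id ℝ _) ε b L (g i)) →
      ∫ v, ∏ i, g i (B i v) ^ (c i) ∂μ ≤ ∏ i, (∫ u, g i u ∂(gblMeasure _)) ^ (c i) := by
    intro ε hε g hg
    choose b L hL hn using hg
    have hb' : ∀ i, b i ≤ ∑ j, |b j| := fun i =>
      (le_abs_self _).trans (Finset.single_le_sum (f := fun j => |b j|)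
        (fun j _ => abs_nonneg _) (Finset.mem_univ i))
    have hL' : ∀ i, L i ≤ ∑ j, L j := fun i =>
      Finset.single_le_sum (f := L) (fun j _ => hL j) (Finset.mem_univ i)
    have hn' : ∀ i, GblNice (P i) ε (∑ j, |b j|) (∑ j, L j) (fun x => g i (BL i x)) := fun i =>
      ((hn i).comp (hL i) (BL i) (BT i) (hadj i) (hBB i) (hiso i) (hle i)).mono (hb' i) (hL' i)
    have hs1 : (Real.sqrt (2 * π))⁻¹ ≤ 1 := by
      apply inv_le_one_of_one_le₀
      rw [Real.one_le_sqrt]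
      linarith [Real.pi_gt_three]
    have key := gbl_nice c hc P hP ε _ _ hε (Finset.sum_nonneg fun i _ => hL i) _ hn'
      (Real.sqrt (2 * π))⁻¹ (by positivity) hs1
    have hgc : ∀ i, Continuous (g i) := fun i => (hn i).cont
    have hgp : ∀ i x, 0 < g i x := fun i x => hε.trans_le ((hn i).lb x)
    have l1 : ∫ v, ∏ i, g i (B i v) ^ (c i) ∂μ = _ :=
      integral_map (by fun_prop) (Continuous.aestronglyMeasurable
        (continuous_finsetProd _ fun i _ =>
          ((hgc i).comp (hBc i)).rpow_const fun x => Or.inl (hgp i _).ne'))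
    have l2 : ∀ i, ∫ u, g i u ∂(gblMeasure _) = ∫ v, g i (BL i v) ∂μ := fun i => by
      rw [← hmap i]
      exact integral_map (by fun_prop) (hgc i).aestronglyMeasurable
    have l3 : ∀ i, ∫ v, g i (BL i v) ∂μ = _ := fun i =>
      integral_map (by fun_prop) ((hgc i).comp (BL i).continuous).aestronglyMeasurable
    rw [l1]
    simp only [l2, l3]
    exact key
  -- approximating sequence
  have hεn : ∀ n : ℕ, 0 < 1 / ((n : ℝ) + 1) := fun n => by positivity
  choose g hgn hgi hgd using fun (n : ℕ) i => gbl_approx (hf_nonneg i) (hfi i) (hεn n)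
  have hgc : ∀ n i, Continuous (g n i) := fun n i => by
    obtain ⟨b, L, hL, hn⟩ := hgn n i
    exact hn.cont
  have hgp : ∀ n i x, 0 < g n i x := fun n i x => by
    obtain ⟨b, L, hL, hn⟩ := hgn n i
    exact (hεn n).trans_le (hn.lb x)
  have hlim0 : Filter.Tendsto (fun n : ℕ => 2 * (1 / ((n : ℝ) + 1))) Filter.atTop (nhds 0) := by
    simpa using (tendsto_one_div_add_atTop_nhds_zero_nat (𝕜 := ℝ)).const_mul 2
  have hlimI : ∀ i, Filter.Tendsto (fun n => ∫ u, g n i u ∂(gblMeasure _)) Filter.atTop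
      (nhds (∫ u, f i u ∂(gblMeasure _))) := by
    intro i
    rw [tendsto_iff_norm_sub_tendsto_zero]
    refine squeeze_zero (fun n => norm_nonneg _) (fun n => ?_) hlim0
    rw [norm_sub_rev, ← integral_sub (hfi i) (hgi n i)]
    exact (norm_integral_le_integral_norm _).trans (hgd n i)
  have hlimJ : Filter.Tendsto (fun n => ∏ i, (∫ u, g n i u ∂(gblMeasure _)) ^ (c i)) Filter.atTop
      (nhds (∏ i, (∫ u, f i u ∂(gblMeasure _)) ^ (c i))) :=
    tendsto_finsetProd _ fun i _ => (hlimI i).rpow_const (Or.inr (hc i))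
  have hdi : ∀ n i, Integrable (fun v => |f i (BL i v) - g n i (BL i v)|) μ := fun n i =>
    (hmp i).integrable_comp_of_integrable ((hfi i).sub (hgi n i)).abs
  have hdI : ∀ n i, ∫ v, |f i (BL i v) - g n i (BL i v)| ∂μ ≤ 2 * (1 / ((n : ℝ) + 1)) := by
    intro n i
    refine le_trans (le_of_eq ?_) (hgd n i)
    rw [← hmap i]
    have hm : Measurable (fun u => |f i u - g n i u|) :=
      continuous_abs.measurable.comp ((hf_meas i).sub (hgc n i).measurable)
    exact (integral_map (φ := BL i) (f := fun u => |f i u - g n i u|)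
      (BL i).continuous.aemeasurable hm.aestronglyMeasurable).symm
  have hTM : TendstoInMeasure μ (fun n v => ∑ i, |f i (BL i v) - g n i (BL i v)|) Filter.atTop
      (fun _ => 0) := by
    have hmeas : ∀ n, Integrable (fun v => ∑ i, |f i (BL i v) - g n i (BL i v)|) μ := fun n =>
      integrable_finsetSum _ fun i _ => hdi n i
    refine tendstoInMeasure_of_tendsto_eLpNorm (p := 1) (by simp)
      (fun n => (hmeas n).aestronglyMeasurable) aestronglyMeasurable_const ?_
    have hr : Filter.Tendsto (fun n : ℕ => ENNReal.ofReal (∑ i : Fin K, 2 * (1 / ((n : ℝ) + 1))))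
        Filter.atTop (nhds 0) := by
      rw [← ENNReal.ofReal_zero]
      refine ENNReal.tendsto_ofReal ?_
      simpa using hlim0.const_mul (K : ℝ)
    refine tendsto_of_tendsto_of_tendsto_of_le_of_le tendsto_const_nhds hr
      (fun n => zero_le) fun n => ?_
    simp only
    rw [eLpNorm_one_eq_lintegral_enorm]
    have h0 : ∀ v, 0 ≤ ∑ i, |f i (BL i v) - g n i (BL i v)| := fun v =>
      Finset.sum_nonneg fun i _ => abs_nonneg _
    have : ∀ v : EuclideanSpace ℝ (Fin M), ‖((fun v : EuclideanSpace ℝ (Fin M) => ∑ i, |f i (BL i v) - g n i (BL i v)|) - (fun _ => (0:ℝ)) : EuclideanSpace ℝ (Fin M) → ℝ) v‖ₑ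
        = ENNReal.ofReal (∑ i, |f i (BL i v) - g n i (BL i v)|) := by
      intro v
      simp only [Pi.sub_apply, sub_zero]
      rw [Real.enorm_of_nonneg (h0 v)]
    simp only [this]
    rw [← ofReal_integral_eq_lintegral_ofReal (hmeas n) (Filter.Eventually.of_forall h0)]
    refine ENNReal.ofReal_le_ofReal ?_
    rw [integral_finsetSum _ fun i _ => hdi n i]
    exact Finset.sum_le_sum fun i _ => hdI n i
  obtain ⟨ns, hns, hae⟩ := hTM.exists_seq_tendsto_ae
  have hprod : ∀ᵐ v ∂μ, Filter.Tendsto (fun k => ∏ i, g (ns k) i (B i v) ^ (c i)) Filter.atTop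
      (nhds (∏ i, f i (B i v) ^ (c i))) := by
    filter_upwards [hae] with v hv
    refine tendsto_finsetProd _ fun i _ => Filter.Tendsto.rpow_const ?_ (Or.inr (hc i))
    rw [tendsto_iff_norm_sub_tendsto_zero]
    refine squeeze_zero (fun n => norm_nonneg _) (fun n => ?_) hv
    rw [norm_sub_rev]
    exact Finset.single_le_sum (f := fun i => |f i (BL i v) - g (ns n) i (BL i v)|)
      (fun j _ => abs_nonneg _) (Finset.mem_univ i)
  have hFmeas : Measurable (fun v => ∏ i, f i (B i v) ^ (c i)) :=
    Finset.measurable_prod _ fun i _ => ((hf_meas i).comp (hBc i).measurable).pow_const _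
  have hGmeas : ∀ n, Measurable (fun v => ∏ i, g n i (B i v) ^ (c i)) := fun n =>
    Finset.measurable_prod _ fun i _ => ((hgc n i).measurable.comp (hBc i).measurable).pow_const _
  have hF0 : ∀ v, 0 ≤ ∏ i, f i (B i v) ^ (c i) := fun v =>
    Finset.prod_nonneg fun i _ => Real.rpow_nonneg (hf_nonneg _ _) _
  have hG0 : ∀ n v, 0 ≤ ∏ i, g n i (B i v) ^ (c i) := fun n v =>
    Finset.prod_nonneg fun i _ => Real.rpow_nonneg (hgp _ _ _).le _
  have hGint : ∀ n, Integrable (fun v => ∏ i, g n i (B i v) ^ (c i)) μ := by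
    intro n
    choose b L hL hn using hgn n
    refine Integrable.of_bound (hGmeas n).aestronglyMeasurable (∏ i, (b i) ^ (c i))
      (Filter.Eventually.of_forall fun v => ?_)
    rw [Real.norm_eq_abs, abs_of_nonneg (hG0 n v)]
    exact Finset.prod_le_prod (fun i _ => Real.rpow_nonneg (hgp _ _ _).le _) fun i _ =>
      Real.rpow_le_rpow (hgp _ _ _).le ((hn i).ub _) (hc i)
  have hJ0 : 0 ≤ ∏ i, (∫ u, f i u ∂(gblMeasure _)) ^ (c i) :=
    Finset.prod_nonneg fun i _ => Real.rpow_nonneg (integral_nonneg (hf_nonneg i)) _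
  rw [integral_eq_lintegral_of_nonneg_ae (Filter.Eventually.of_forall hF0)
    hFmeas.aestronglyMeasurable]
  refine ENNReal.toReal_le_of_le_ofReal hJ0 ?_
  calc ∫⁻ v, ENNReal.ofReal (∏ i, f i (B i v) ^ (c i)) ∂μ
      = ∫⁻ v, Filter.liminf (fun k => ENNReal.ofReal (∏ i, g (ns k) i (B i v) ^ (c i)))
          Filter.atTop ∂μ := by
        refine lintegral_congr_ae ?_
        filter_upwards [hprod] with v hv
        exact (ENNReal.tendsto_ofReal hv).liminf_eq.symm
    _ ≤ Filter.liminf (fun k => ∫⁻ v, ENNReal.ofReal (∏ i, g (ns k) i (B i v) ^ (c i)) ∂μ)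
          Filter.atTop := lintegral_liminf_le fun k => (hGmeas _).ennreal_ofReal
    _ ≤ Filter.liminf (fun k => ENNReal.ofReal
          (∏ i, (∫ u, g (ns k) i u ∂(gblMeasure _)) ^ (c i))) Filter.atTop := by
        refine Filter.liminf_le_liminf (Filter.Eventually.of_forall fun k => ?_)
        rw [← ofReal_integral_eq_lintegral_ofReal (hGint _)
          (Filter.Eventually.of_forall (hG0 _))]
        exact ENNReal.ofReal_le_ofReal (nice_ineq _ (hεn _) _ (hgn _))
    _ = _ := (ENNReal.tendsto_ofReal (hlimJ.comp hns.tendsto_atTop)).liminf_eq
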